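/- Let P ∈ 𝒱 be a nondecreasing fixed point of Φ that is not basic, and let A = {k : |p_k| < 1} (which is nonempty). Then there exists d > 0 such that for every nondecreasing V ∈ 𝒱 with ρ(V, P) < d and Σ_{k ∈ A} v_k ≠ 0, there exists n > 0 with ρ(Φ^n(V), P) ≥ d. -/

import Mathlib

open Finset Filter

/-- `J ε V k` is the set of indices `l` whose opinions are `ε`-close to `V k`. -/
noncomputable def J {N : ℕ} (ε : ℝ) (V : Fin N → ℝ) (k : Fin N) : Finset (Fin N) :=
  Finset.univ.filter (fun l => |V l - V k| ≤ ε)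

/-- `w h ε V k = v_k + (h / I(v_k)) · Σ_{l ∈ J(v_k)} v_l`. -/
noncomputable def w {N : ℕ} (h ε : ℝ) (V : Fin N → ℝ) (k : Fin N) : ℝ :=
  V k + (h / (J ε V k).card) * ∑ l ∈ J ε V k, V l

/-- The opinion-dynamics operator `Φ`, obtained from `w` by cutting at `±1`. -/
noncomputable def Phi {N : ℕ} (h ε : ℝ) (V : Fin N → ℝ) : Fin N → ℝ :=
  fun k => max (-1) (min 1 (w h ε V k))

/-- The metric `ρ(V, V') = max_k |v_k − v'_k|` on `𝒱`. -/
noncomputable def rho {N : ℕ} (V V' : Fin N → ℝ) : ℝ := ⨆ k, |V k - V' k|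

open Topology

section Interior

variable {N : ℕ} {h ε : ℝ}

theorem mem_J {V : Fin N → ℝ} {k l : Fin N} : l ∈ J ε V k ↔ |V l - V k| ≤ ε := by
  simp [J]

theorem Phi_eq_w_of_abs_lt {V : Fin N → ℝ} {k : Fin N} (hk : |Phi h ε V k| < 1) :
    Phi h ε V k = w h ε V k := by
  rw [abs_lt] at hk
  obtain ⟨h1, h2⟩ := hk
  unfold Phi at *
  rcases max_cases (-1) (min 1 (w h ε V k)) with h3 | h3 <;>
  rcases min_cases 1 (w h ε V k) with h4 | h4 <;> linarith [h3.1, h4.1]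

theorem abs_sub_le_rho (V V' : Fin N → ℝ) (k : Fin N) : |V k - V' k| ≤ rho V V' :=
  le_ciSup (f := fun k => |V k - V' k|) (Set.finite_range _).bddAbove k

/-- At an interior coordinate of a fixed point the neighbourhood sum vanishes. -/
theorem sum_J_eq_zero {P : Fin N → ℝ} (hh : 0 < h) (hε : 0 ≤ ε) (hfix : Phi h ε P = P)
    {k : Fin N} (hk : |P k| < 1) : ∑ l ∈ J ε P k, P l = 0 := by
  have h1 := Phi_eq_w_of_abs_lt (h := h) (ε := ε) (V := P) (k := k) (by rwa [hfix])
  rw [hfix, w, left_eq_add] at h1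
  have hc : 0 < (J ε P k).card := Finset.card_pos.2 ⟨k, by simpa [mem_J] using hε⟩
  have hc' : (0 : ℝ) < (J ε P k).card := by exact_mod_cast hc
  exact (mul_eq_zero.1 h1).resolve_left (by positivity)

/-- Interior coordinates of opposite sign that see each other have the same neighbourhood. -/
theorem J_eq_of_nonpos_of_nonneg {P : Fin N → ℝ} {k l : Fin N}
    (hk : ∑ j ∈ J ε P k, P j = 0) (hl : ∑ j ∈ J ε P l, P j = 0)
    (hl0 : P l ≤ 0) (hk0 : 0 ≤ P k) (hkl : P k - P l ≤ ε) : J ε P k = J ε P l := by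
  have hpos : ∀ j ∈ J ε P k \ J ε P l, 0 < P j := by
    intro j hj
    simp only [Finset.mem_sdiff, mem_J, abs_le, not_and_or, not_le] at hj
    rcases hj with ⟨⟨_, _⟩, _ | _⟩ <;> linarith
  have hneg : ∀ j ∈ J ε P l \ J ε P k, P j < 0 := by
    intro j hj
    simp only [Finset.mem_sdiff, mem_J, abs_le, not_and_or, not_le] at hj
    rcases hj with ⟨⟨_, _⟩, _ | _⟩ <;> linarith
  have h1 := Finset.sum_sdiff_sub_sum_sdiff (s₁ := J ε P l) (s₂ := J ε P k) (f := P)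
  have hp0 := Finset.sum_nonneg fun j hj => (hpos j hj).le
  have hn0 := Finset.sum_nonpos fun j hj => (hneg j hj).le
  refine Finset.Subset.antisymm ?_ ?_ <;> rw [← Finset.sdiff_eq_empty_iff_subset] <;>
    by_contra hne <;> rw [← Ne, ← Finset.nonempty_iff_ne_empty] at hne
  · have := Finset.sum_pos hpos hne
    linarith
  · have := Finset.sum_neg hneg hne
    linarith

/-- All interior coordinates of a fixed point share the same neighbourhood, namely the set of
interior coordinates. -/
theorem J_eq_interior {P : Fin N → ℝ} (hh : 0 < h) (hε : ε ∈ Set.Ioo (0 : ℝ) 1)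
    (hfix : Phi h ε P = P) {k : Fin N} (hk : |P k| < 1) :
    J ε P k = Finset.univ.filter (fun k => |P k| < 1) := by
  obtain ⟨hε0, hε1⟩ := hε
  have self : ∀ k, k ∈ J ε P k := fun k => by simpa [mem_J] using hε0.le
  have sum0 : ∀ k, |P k| < 1 → ∑ l ∈ J ε P k, P l = 0 := fun k hk =>
    sum_J_eq_zero hh hε0.le hfix hk
  have low : ∀ k, |P k| < 1 → 0 ≤ P k → ∃ l, |P l| < 1 ∧ P l ≤ 0 ∧ P k - P l ≤ ε := by
    intro k hk hk0
    obtain ⟨l, hl, hl0⟩ := Finset.exists_le_of_sum_le (f := P) (g := fun _ => 0) ⟨k, self k⟩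
      (by simp [sum0 k hk])
    rw [mem_J, abs_le] at hl
    exact ⟨l, abs_lt.2 ⟨by linarith, by linarith⟩, hl0, by linarith⟩
  have high : ∀ k, |P k| < 1 → P k ≤ 0 → ∃ l, |P l| < 1 ∧ 0 ≤ P l ∧ P l - P k ≤ ε := by
    intro k hk hk0
    obtain ⟨l, hl, hl0⟩ := Finset.exists_le_of_sum_le (f := fun _ => 0) (g := P) ⟨k, self k⟩
      (by simp [sum0 k hk])
    rw [mem_J, abs_le] at hl
    exact ⟨l, abs_lt.2 ⟨by linarith, by linarith⟩, hl0, by linarith⟩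
  have opp : ∀ k l, |P k| < 1 → |P l| < 1 → P l ≤ 0 → 0 ≤ P k → P k - P l ≤ ε →
      J ε P k = J ε P l := fun k l hk hl =>
    J_eq_of_nonpos_of_nonneg (sum0 k hk) (sum0 l hl)
  have same : ∀ k m, |P k| < 1 → |P m| < 1 → 0 ≤ P k → P k ≤ P m → J ε P k = J ε P m := by
    intro k m hk hm hk0 hkm
    obtain ⟨l, hl, hl0, hml⟩ := low m hm (hk0.trans hkm)
    rw [opp k l hk hl hl0 hk0 (by linarith), opp m l hm hl hl0 (hk0.trans hkm) hml]
  have nonneg : ∀ k m, |P k| < 1 → |P m| < 1 → 0 ≤ P k → 0 ≤ P m → J ε P k = J ε P m := by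
    intro k m hk hm hk0 hm0
    rcases le_total (P k) (P m) with hkm | hkm
    · exact same k m hk hm hk0 hkm
    · exact (same m k hm hk hm0 hkm).symm
  have rep : ∀ k, |P k| < 1 → ∃ m, |P m| < 1 ∧ 0 ≤ P m ∧ J ε P k = J ε P m := by
    intro k hk
    rcases le_total 0 (P k) with hk0 | hk0
    · exact ⟨k, hk, hk0, rfl⟩
    · obtain ⟨m, hm, hm0, hmk⟩ := high k hk hk0
      exact ⟨m, hm, hm0, (opp m k hm hk hk0 hm0 hmk).symm⟩
  have all : ∀ k m, |P k| < 1 → |P m| < 1 → J ε P k = J ε P m := by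
    intro k m hk hm
    obtain ⟨k', hk', hk0, e⟩ := rep k hk
    obtain ⟨m', hm', hm0, e'⟩ := rep m hm
    rw [e, e', nonneg k' m' hk' hm' hk0 hm0]
  obtain ⟨m, hm, hm0, e⟩ := rep k hk
  obtain ⟨l, hl, hl0, -⟩ := low m hm hm0
  ext j
  simp only [Finset.mem_filter, Finset.mem_univ, true_and]
  constructor
  · intro hj
    have h1 := hj
    rw [all k m hk hm, mem_J, abs_le] at h1
    rw [all k l hk hl, mem_J, abs_le] at hj
    exact abs_lt.2 ⟨by linarith, by linarith⟩
  · intro hj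
    rw [all k j hk hj]
    exact self j

end Interior

section ZeroSum

variable {ι : Type*} [DecidableEq ι] {A T : Finset ι} {x : ι → ℝ} {k : ι} {ε : ℝ}

theorem forall_sub_ne_of_sum_eq_zero (hε : 0 < ε) (hA : ∑ j ∈ A, x j = 0)
    (hd : ∀ i ∈ A, ∀ j ∈ A, |x i - x j| ≤ ε) (hk : k ∈ A) (hTA : T ⊆ A)
    (hT : ∑ j ∈ T, x j = 0) (hmiss : ∀ l ∈ A \ T, ε ≤ |x l - x k|) :
    ∀ l ∈ A \ T, x l - x k ≠ ε := by
  intro l hl hlk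
  have hlA := (Finset.mem_sdiff.1 hl).1
  have hle : ∀ j ∈ A, x j ≤ x l := fun j hj => by
    have := (abs_le.1 (hd j hj k hk)).2
    linarith
  have hl0 : 0 < x l := by
    by_contra hl0
    have : ∑ j ∈ A, x j < ∑ j ∈ A, (0 : ℝ) :=
      Finset.sum_lt_sum (fun j hj => by linarith [hle j hj]) ⟨k, hk, by linarith⟩
    simp [hA] at this
  have hm : ∀ m ∈ A \ T, 0 < x m := by
    intro m hm
    have h1 := (abs_le.1 (hd m (Finset.mem_sdiff.1 hm).1 l hlA)).1
    rcases le_abs.1 (hmiss m hm) with h2 | h2 <;> linarith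
  have h1 := Finset.sum_pos hm ⟨l, hl⟩
  have h2 := Finset.sum_sdiff (f := x) hTA
  linarith

/-- A zero-sum family of diameter at most `ε` has no proper zero-sum subfamily obtained by
discarding only members at distance `ε` from a given one. -/
theorem eq_of_sum_eq_zero_of_le_abs_sub (hε : 0 < ε) (hA : ∑ j ∈ A, x j = 0)
    (hd : ∀ i ∈ A, ∀ j ∈ A, |x i - x j| ≤ ε) (hk : k ∈ A) (hTA : T ⊆ A)
    (hT : ∑ j ∈ T, x j = 0) (hmiss : ∀ l ∈ A \ T, ε ≤ |x l - x k|) : T = A := by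
  refine Finset.Subset.antisymm hTA (Finset.sdiff_eq_empty_iff_subset.1 ?_)
  refine Finset.eq_empty_of_forall_notMem fun l hl => ?_
  have neg_sub_neg' : ∀ i j, |(-x) i - (-x) j| = |x i - x j| := fun i j => by
    rw [Pi.neg_apply, Pi.neg_apply, neg_sub_neg, abs_sub_comm]
  have h1 := forall_sub_ne_of_sum_eq_zero hε hA hd hk hTA hT hmiss l hl
  have h2 := forall_sub_ne_of_sum_eq_zero (x := -x) hε (by simp [hA])
    (by simpa only [neg_sub_neg'] using hd) hk hTA (by simp [hT])
    (by simpa only [neg_sub_neg'] using hmiss) l hl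
  have h3 := le_antisymm (hd l (Finset.mem_sdiff.1 hl).1 k hk) (hmiss l hl)
  simp only [Pi.neg_apply] at h2
  rcases (abs_eq hε.le).1 h3 with h4 | h4
  · exact h1 h4
  · exact h2 (by linarith)

end ZeroSum

theorem eventually_mul_lt_of_imp_pos {p : Prop} {c a : ℝ} (ha : p → 0 < a) :
    ∀ᶠ d in 𝓝[>] (0 : ℝ), p → c * d < a := by
  by_cases hp : p
  · have : Tendsto (fun d : ℝ => c * d) (𝓝[>] 0) (𝓝 0) := by
      have h1 : Continuous fun d : ℝ => c * d := by fun_prop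
      simpa using (h1.tendsto 0).mono_left nhdsWithin_le_nhds
    filter_upwards [this.eventually_lt_const (ha hp)] with d hd _ using hd
  · exact Eventually.of_forall fun d hp' => absurd hp' hp

/-- A radius below all the finitely many positive gaps attached to the configuration `P`. -/
theorem exists_radius {N : ℕ} (P : Fin N → ℝ) (ε c : ℝ) :
    ∃ d > (0 : ℝ), (∀ k, |P k| < 1 → 1 * d < 1 - |P k|) ∧
      (∀ k l, |P l - P k| < ε → 2 * d < ε - |P l - P k|) ∧
      (∀ k l, ε < |P l - P k| → 2 * d < |P l - P k| - ε) ∧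
      ∀ T : Finset (Fin N), ∑ l ∈ T, P l ≠ 0 → c * d < |∑ l ∈ T, P l| := by
  have h1 : ∀ᶠ d in 𝓝[>] (0 : ℝ), ∀ k, |P k| < 1 → 1 * d < 1 - |P k| :=
    eventually_all.2 fun k => eventually_mul_lt_of_imp_pos sub_pos.2
  have h2 : ∀ᶠ d in 𝓝[>] (0 : ℝ), ∀ k l, |P l - P k| < ε → 2 * d < ε - |P l - P k| :=
    eventually_all.2 fun k => eventually_all.2 fun l => eventually_mul_lt_of_imp_pos sub_pos.2
  have h3 : ∀ᶠ d in 𝓝[>] (0 : ℝ), ∀ k l, ε < |P l - P k| → 2 * d < |P l - P k| - ε :=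
    eventually_all.2 fun k => eventually_all.2 fun l => eventually_mul_lt_of_imp_pos sub_pos.2
  have h4 : ∀ᶠ d in 𝓝[>] (0 : ℝ), ∀ T : Finset (Fin N), ∑ l ∈ T, P l ≠ 0 →
      c * d < |∑ l ∈ T, P l| :=
    eventually_all.2 fun T => eventually_mul_lt_of_imp_pos abs_pos.2
  obtain ⟨d, hd, h⟩ :=
    (eventually_mem_nhdsWithin.and (h1.and (h2.and (h3.and h4)))).exists
  exact ⟨d, hd, h⟩

theorem abs_sum_sub_le {N : ℕ} {V P : Fin N → ℝ} {d : ℝ} (hd : 0 ≤ d)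
    (hV : ∀ k, |V k - P k| ≤ d) (T : Finset (Fin N)) :
    |∑ l ∈ T, V l - ∑ l ∈ T, P l| ≤ N * d := by
  rw [← Finset.sum_sub_distrib]
  calc |∑ l ∈ T, (V l - P l)| ≤ ∑ l ∈ T, |V l - P l| := Finset.abs_sum_le_sum_abs _ _
    _ ≤ T.card * d := by
      simpa using Finset.sum_le_card_nsmul T _ d fun l _ => hV l
    _ ≤ N * d := by
      have : T.card ≤ N := by simpa using T.card_le_univ
      gcongr

/-- Theorem 3: let `P ∈ 𝒱` be a nondecreasing nonbasic fixed
point of `Φ`, with `A = {k : |p_k| < 1}` nonempty. Then there exists `d > 0`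
such that every nondecreasing `V ∈ 𝒱` with `ρ(V, P) < d` and
`Σ_{k ∈ A} v_k ≠ 0` eventually leaves the `d`-neighborhood of `P`. -/
theorem statement11 (N : ℕ) (hN : 1 ≤ N) (h ε : ℝ)
    (hh : h ∈ Set.Ioo (0 : ℝ) 1) (hε : ε ∈ Set.Ioo (0 : ℝ) 1)
    (P : Fin N → ℝ) (hP : ∀ k, P k ∈ Set.Icc (-1 : ℝ) 1) (hmono : Monotone P)
    (hfix : Phi h ε P = P)
    (A : Finset (Fin N)) (hA : A = Finset.univ.filter (fun k => |P k| < 1))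
    (hne : A.Nonempty) :
    ∃ d > (0 : ℝ), ∀ V : Fin N → ℝ,
      (∀ k, V k ∈ Set.Icc (-1 : ℝ) 1) → Monotone V →
      rho V P < d → ∑ k ∈ A, V k ≠ 0 →
      ∃ n > 0, d ≤ rho ((Phi h ε)^[n] V) P := by
  obtain ⟨hh0, -⟩ := hh
  have hε0 := hε.1
  have hJA : ∀ k ∈ A, J ε P k = A := fun k hk => by
    rw [hA] at hk ⊢
    exact J_eq_interior hh0 hε hfix (Finset.mem_filter.1 hk).2
  have hAlt : ∀ k ∈ A, |P k| < 1 := fun k hk => by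
    rw [hA] at hk
    exact (Finset.mem_filter.1 hk).2
  have hsum : ∑ l ∈ A, P l = 0 := by
    obtain ⟨k, hk⟩ := hne
    rw [← hJA k hk]
    exact sum_J_eq_zero hh0 hε0.le hfix (hAlt k hk)
  have hdiam : ∀ i ∈ A, ∀ j ∈ A, |P i - P j| ≤ ε := fun i hi j hj => by
    rwa [← hJA j hj, mem_J] at hi
  have hN0 : (0 : ℝ) < N := by exact_mod_cast hN
  obtain ⟨d, hd, hgap1, hgap2, hgap3, hgap4⟩ := exists_radius P ε (2 * N / h + N)
  refine ⟨d, hd, fun V _ _ hVd hS => ?_⟩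
  by_contra! hcon
  have hstay : ∀ n, rho ((Phi h ε)^[n] V) P < d := fun n => by
    rcases Nat.eq_zero_or_pos n with rfl | hn
    · exact hVd
    · exact hcon n hn
  have step : ∀ U : Fin N → ℝ, rho U P < d → rho (Phi h ε U) P < d →
      ∑ k ∈ A, Phi h ε U k = (1 + h) * ∑ k ∈ A, U k := by
    intro U hU hU'
    have hUk : ∀ k, |U k - P k| < d := fun k => (abs_sub_le_rho U P k).trans_lt hU
    have hUk' : ∀ k, |Phi h ε U k - P k| < d := fun k =>
      (abs_sub_le_rho (Phi h ε U) P k).trans_lt hU'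
    have hw : ∀ k ∈ A, Phi h ε U k = w h ε U k := fun k hk => by
      refine Phi_eq_w_of_abs_lt ?_
      have h1 := hgap1 k (hAlt k hk)
      have h2 := abs_sub_abs_le_abs_sub (Phi h ε U k) (P k)
      linarith [hUk' k]
    have hclose : ∀ k l, |(|U l - U k| - |P l - P k|)| < 2 * d := fun k l => by
      refine (abs_abs_sub_abs_le _ _).trans_lt ?_
      have h1 := abs_lt.1 (hUk k)
      have h2 := abs_lt.1 (hUk l)
      exact abs_lt.2 ⟨by linarith, by linarith⟩
    have hJU : ∀ k ∈ A, J ε U k = A := by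
      intro k hk
      refine eq_of_sum_eq_zero_of_le_abs_sub hε0 hsum hdiam hk ?_ ?_ ?_
      · intro l hl
        rw [← hJA k hk]
        rw [mem_J] at hl ⊢
        by_contra! hlt
        have h1 := hgap3 k l hlt
        have h2 := abs_lt.1 (hclose k l)
        linarith
      · by_contra hne0
        have h1 := hgap4 _ hne0
        have h2 := abs_sum_sub_le hd.le (fun k => (hUk k).le) (J ε U k)
        have hcard : (0 : ℝ) < (J ε U k).card := by
          exact_mod_cast Finset.card_pos.2 ⟨k, by simpa [mem_J] using hε0.le⟩
        have hcardN : ((J ε U k).card : ℝ) ≤ N := by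
          exact_mod_cast (by simpa using (J ε U k).card_le_univ)
        have h3 : |h / (J ε U k).card * ∑ l ∈ J ε U k, U l| < 2 * d := by
          have h4 := abs_lt.1 (hUk k)
          have h5 := hUk' k
          rw [hw k hk, w, abs_lt] at h5
          exact abs_lt.2 ⟨by linarith, by linarith⟩
        rw [abs_mul, abs_of_pos (by positivity : 0 < h / ((J ε U k).card : ℝ))] at h3
        have h4 : h / N * |∑ l ∈ J ε U k, U l| < 2 * d := lt_of_le_of_lt (by gcongr) h3
        have h5 : |∑ l ∈ J ε U k, U l| < 2 * N / h * d := by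
          calc |∑ l ∈ J ε U k, U l| = N / h * (h / N * |∑ l ∈ J ε U k, U l|) := by
                field_simp
            _ < N / h * (2 * d) := by gcongr
            _ = 2 * N / h * d := by ring
        have h6 := abs_sub_abs_le_abs_sub (∑ l ∈ J ε U k, P l) (∑ l ∈ J ε U k, U l)
        rw [abs_sub_comm] at h6
        linarith
      · intro l hl
        rw [Finset.mem_sdiff, mem_J, not_le] at hl
        by_contra! hlt
        have h1 := hgap2 k l hlt
        have h2 := abs_lt.1 (hclose k l)
        linarith
    have hcard : (A.card : ℝ) ≠ 0 := by exact_mod_cast (Finset.card_pos.2 hne).ne'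
    rw [Finset.sum_congr rfl fun k hk => by rw [hw k hk, w, hJU k hk],
      Finset.sum_add_distrib, Finset.sum_const, nsmul_eq_mul]
    field_simp
  have hgrow : ∀ n, ∑ k ∈ A, (Phi h ε)^[n] V k = (1 + h) ^ n * ∑ k ∈ A, V k := by
    intro n
    induction n with
    | zero => simp
    | succ n ih =>
      have h1 := hstay (n + 1)
      rw [Function.iterate_succ_apply'] at h1 ⊢
      rw [step _ (hstay n) h1, ih]
      ring
  have hS0 := abs_pos.2 hS
  obtain ⟨n, hn⟩ := pow_unbounded_of_one_lt (N * d / |∑ k ∈ A, V k|)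
    (by linarith : (1 : ℝ) < 1 + h)
  have h1 := abs_sum_sub_le hd.le
    (fun k => ((abs_sub_le_rho ((Phi h ε)^[n] V) P k).trans_lt (hstay n)).le) A
  rw [hsum, sub_zero, hgrow, abs_mul, abs_of_pos (by positivity)] at h1
  rw [div_lt_iff₀ hS0] at hn
  linarith
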